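/- Let X be a δ-hyperbolic metric space with basepoint o and let μ be a non-elementary discrete probability measure on the isometry group of X. For every η > 0 there exists C > 0 such that for every D > 0 there exist M ∈ ℕ and an (η, C, D)-Schottky set contained in the support of the M-fold convolution power μ^{*M}. -/

import Mathlib

open Filter MeasureTheory
open scoped ENNReal NNReal Classical

noncomputable section

/-- The Gromov product `(x,z)_a`. -/
def gromov {X : Type*} [MetricSpace X] (x z a : X) : ℝ :=
  (dist a x + dist a z - dist x z) / 2

/-- `X` is `δ`-hyperbolic. -/
def IsDeltaHyperbolic (X : Type*) [MetricSpace X] (δ : ℝ) : Prop :=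
  ∀ x y z a : X, min (gromov x y a) (gromov y z a) - δ ≤ gromov x z a

/-- An isometry `g` of `X` is loxodromic: `d(o, g^n o)/n` converges to a positive limit. -/
def Loxodromic {X : Type*} [MetricSpace X] (o : X) (g : X ≃ᵢ X) : Prop :=
  ∃ L : ℝ, 0 < L ∧ Tendsto (fun n : ℕ => dist o ((g ^ n) o) / n) atTop (nhds L)

/-- Two isometries have disjoint fixed point sets at infinity:
for all signs `ε, ε' ∈ {1, -1}`, `sup_{n,m ≥ 1} (u^{εn}·o, v^{ε'm}·o)_o < ∞`. -/
def DisjointFixedPointsAtInfinity {X : Type*} [MetricSpace X] (o : X) (u v : X ≃ᵢ X) : Prop :=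
  ∀ ε ε' : ℤ, (ε = 1 ∨ ε = -1) → (ε' = 1 ∨ ε' = -1) →
    ∃ B : ℝ, ∀ n m : ℕ, 1 ≤ n → 1 ≤ m →
      gromov ((u ^ (ε * (n : ℤ))) o) ((v ^ (ε' * (m : ℤ))) o) o ≤ B

/-- A (discrete) probability measure on the isometry group of `X` is non-elementary if
the semigroup generated by its support contains two loxodromic elements with disjoint
fixed point sets at infinity. -/
def NonElementary {X : Type*} [MetricSpace X] (o : X) (μ : PMF (X ≃ᵢ X)) : Prop :=
  ∃ u v : X ≃ᵢ X,
    u ∈ Subsemigroup.closure μ.support ∧ v ∈ Subsemigroup.closure μ.support ∧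
      Loxodromic o u ∧ Loxodromic o v ∧ DisjointFixedPointsAtInfinity o u v

/-- The random walk `Z_n = g_0 g_1 ⋯ g_{n-1}`. -/
def RW {G : Type*} [Group G] {Ω : Type*} (g : ℕ → Ω → G) (n : ℕ) (ω : Ω) : G :=
  ((List.range n).map fun i => g i ω).prod

/-- The increments `g_i` are i.i.d. with (discrete) law `μ`: the cylinder events have
the product probabilities. -/
def IsIIDWalk {G Ω : Type*} [MeasurableSpace Ω] (P : Measure Ω) (μ : PMF G)
    (g : ℕ → Ω → G) : Prop :=
  ∀ (n : ℕ) (a : ℕ → G),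
    P {ω | ∀ i < n, g i ω = a i} = ∏ i ∈ Finset.range n, μ (a i)

/-- The `n`-fold convolution power of a discrete measure on a group. -/
def convPow {G : Type*} [Group G] (μ : PMF G) : ℕ → PMF G
  | 0 => PMF.pure 1
  | n + 1 => (convPow μ n).bind fun a => μ.map fun b => a * b

/-- The expected distance to the basepoint after `n` steps of the `μ`-random walk. -/
def avgDist {X : Type*} [MetricSpace X] (o : X) (μ : PMF (X ≃ᵢ X)) (n : ℕ) : ℝ≥0∞ :=
  ∑' g : X ≃ᵢ X, convPow μ n g * ENNReal.ofReal (dist o (g o))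

/-- The escape rate `ℓ(μ) = lim E[d(o, Z_n·o)]/n`, as an extended real number.
(The limit exists by subadditivity when `μ` has a finite first moment, and the liminf
equals `+∞` otherwise, so this liminf is a faithful definition in all cases.) -/
def escapeRate {X : Type*} [MetricSpace X] (o : X) (μ : PMF (X ≃ᵢ X)) : EReal :=
  Filter.liminf (fun n : ℕ => ((avgDist o μ n / (n : ℝ≥0∞) : ℝ≥0∞) : EReal)) Filter.atTop

/-- A finite set `S` of isometries of `X` is `(η, C, D)`-Schottky. -/
def IsSchottky {X : Type*} [MetricSpace X] (o : X) (η C D : ℝ)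
    (S : Finset (X ≃ᵢ X)) : Prop :=
  (∀ x y : X, (1 - η) * S.card ≤ ({s ∈ (S : Set (X ≃ᵢ X)) | gromov x (s y) o ≤ C}.ncard : ℝ)) ∧
  (∀ x y : X, (1 - η) * S.card ≤ ({s ∈ (S : Set (X ≃ᵢ X)) | gromov x (s⁻¹ y) o ≤ C}.ncard : ℝ)) ∧
  ∀ s ∈ S, D ≤ dist o (s o)

section Schottky

variable {X : Type*} [MetricSpace X]

lemma gromov_comm (x z a : X) : gromov x z a = gromov z x a := by
  unfold gromov
  rw [dist_comm x z]
  ring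

lemma gromov_isometry (g : X ≃ᵢ X) (x z a : X) : gromov (g x) (g z) (g a) = gromov x z a := by
  simp only [gromov, g.isometry.dist_eq]

lemma gromov_self (x a : X) : gromov x x a = dist a x := by
  simp [gromov]

lemma gromov_le_add_dist (x x' z z' a a' : X) :
    gromov x z a ≤ gromov x' z' a' + (dist x x' + dist z z' + dist a a') := by
  unfold gromov
  have h₁ := dist_triangle4 a a' x' x
  have h₂ := dist_triangle4 a a' z' z
  have h₃ := dist_triangle4 x' x z z'
  rw [dist_comm x' x] at h₁ h₃
  rw [dist_comm z' z] at h₂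
  linarith

lemma dist_inv_apply (g : X ≃ᵢ X) (o : X) : dist o (g⁻¹ o) = dist o (g o) := by
  rw [← g.isometry.dist_eq, ← IsometryEquiv.mul_apply, dist_comm]
  simp

/-- Translating by `g` exchanges the roles of `o` and `g o`. -/
lemma gromov_apply_apply (g : X ≃ᵢ X) (y o : X) :
    gromov (g y) (g o) o = dist o (g o) - gromov y (g⁻¹ o) o := by
  have h₁ : dist (g⁻¹ o) y = dist o (g y) := by
    rw [← g.isometry.dist_eq, ← IsometryEquiv.mul_apply]
    simp
  unfold gromov
  rw [dist_inv_apply, dist_comm y (g⁻¹ o), h₁, g.isometry.dist_eq, dist_comm y o]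
  ring

lemma dist_mul_apply_le (g h : X ≃ᵢ X) (o : X) :
    dist o ((g * h) o) ≤ dist o (g o) + dist o (h o) := by
  have := dist_triangle o (g o) (g (h o))
  rwa [g.isometry.dist_eq] at this

lemma dist_pow_apply_le (g : X ≃ᵢ X) (o : X) (n : ℕ) :
    dist o ((g ^ n) o) ≤ n * dist o (g o) := by
  induction n with
  | zero => simp
  | succ n ih =>
    have := dist_mul_apply_le (g ^ n) g o
    rw [pow_succ]
    push_cast
    linarith

/-- The direction of `h o` is moved away from itself by `g`, when `g` is long and `h o` is
transverse to both `g o` and `g⁻¹ o`. -/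
lemma gromov_apply_le_of_transverse {δ B : ℝ} (hX : IsDeltaHyperbolic X δ) {o : X}
    {g h : X ≃ᵢ X} (h₁ : gromov (g o) (h o) o ≤ B) (h₂ : gromov (g⁻¹ o) (h o) o ≤ B)
    (h₃ : 2 * B + δ < dist o (g o)) : gromov (h o) (g (h o)) o ≤ B + δ := by
  have h₄ := hX (h o) (g (h o)) (g o) o
  rw [gromov_apply_apply, gromov_comm (h o) (g⁻¹ o), gromov_comm (h o) (g o)] at h₄
  by_contra! hlt
  have := lt_min hlt (show B + δ < dist o (g o) - gromov (g⁻¹ o) (h o) o by linarith)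
  linarith

lemma gromov_pow_mul_pow_le {δ B : ℝ} (hX : IsDeltaHyperbolic X δ) {o : X} {a h : X ≃ᵢ X}
    (h₁ : ∀ m : ℕ, 1 ≤ m → gromov ((a ^ m) o) (h o) o ≤ B)
    (h₂ : ∀ m : ℕ, 1 ≤ m → gromov ((a ^ m)⁻¹ o) (h o) o ≤ B)
    (h₃ : ∀ m : ℕ, 1 ≤ m → 2 * B + δ < dist o ((a ^ m) o))
    {K i j k l : ℕ} (hi : i ≤ K) (hj : j ≤ K) (hk : k ≤ K) (hl : l ≤ K) (hij : i ≠ j) :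
    gromov ((a ^ i * h * a ^ k) o) ((a ^ j * h * a ^ l) o) o ≤
      B + δ + 3 * (K * dist o (a o)) := by
  wlog hlt : i < j generalizing i j k l
  · rw [gromov_comm]
    exact this hj hi hl hk hij.symm (by omega)
  obtain ⟨m, rfl⟩ := Nat.exists_eq_add_of_lt hlt
  have hR : ∀ n : ℕ, n ≤ K → dist o ((a ^ n) o) ≤ K * dist o (a o) := fun n hn =>
    (dist_pow_apply_le a o n).trans (by gcongr)
  have hcore := gromov_apply_le_of_transverse hX (h₁ (m + 1) (by omega)) (h₂ (m + 1) (by omega))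
    (h₃ (m + 1) (by omega))
  have hadd : a ^ (i + m + 1) = a ^ i * a ^ (m + 1) := by rw [← pow_add, add_assoc]
  have hshift : gromov ((a ^ i * h * a ^ k) o) ((a ^ (i + m + 1) * h * a ^ l) o) o =
      gromov (h ((a ^ k) o)) ((a ^ (m + 1)) (h ((a ^ l) o))) ((a ^ i)⁻¹ o) := by
    rw [hadd, ← gromov_isometry (a ^ i) (h _), ← IsometryEquiv.mul_apply (a ^ i) (a ^ i)⁻¹]
    simp
  have hpert := gromov_le_add_dist (h ((a ^ k) o)) (h o) ((a ^ (m + 1)) (h ((a ^ l) o)))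
    ((a ^ (m + 1)) (h o)) ((a ^ i)⁻¹ o) o
  simp only [IsometryEquiv.dist_eq] at hpert
  rw [dist_comm _ o, dist_comm _ o, dist_comm _ o, dist_inv_apply] at hpert
  rw [hshift]
  linarith [hR i hi, hR k hk, hR l hl]

/-- Pairwise transverse long isometries satisfy the counting condition of Schottky sets with at
most two exceptions. -/
lemma card_sub_two_le_ncard {δ B : ℝ} (hX : IsDeltaHyperbolic X δ) {o : X}
    (S : Finset (X ≃ᵢ X)) (f : (X ≃ᵢ X) → (X ≃ᵢ X))
    (h₁ : ∀ s ∈ S, ∀ t ∈ S, s ≠ t → gromov (f s o) (f t o) o ≤ B)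
    (h₂ : ∀ s ∈ S, ∀ t ∈ S, s ≠ t → gromov ((f s)⁻¹ o) ((f t)⁻¹ o) o ≤ B)
    (h₃ : ∀ s ∈ S, 2 * B + 3 * δ < dist o (f s o)) (x y : X) :
    (S.card : ℝ) - 2 ≤
      ({s ∈ (S : Set (X ≃ᵢ X)) | gromov x (f s y) o ≤ B + 2 * δ}.ncard : ℝ) := by
  set P := S.filter fun s => B + δ < gromov y ((f s)⁻¹ o) o
  set Q := S.filter fun s => B + δ < gromov x (f s o) o
  set R := S.filter fun s => gromov x (f s y) o ≤ B + 2 * δ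
  have htransverse : ∀ (F : (X ≃ᵢ X) → X),
      (∀ s ∈ S, ∀ t ∈ S, s ≠ t → gromov (F s) (F t) o ≤ B) → ∀ z : X,
      (S.filter fun s => B + δ < gromov z (F s) o).card ≤ 1 := by
    intro F hF z
    refine Finset.card_le_one.2 fun s hs t ht => ?_
    simp only [Finset.mem_filter] at hs ht
    by_contra hst
    have h := hX (F s) z (F t) o
    rw [gromov_comm (F s) z] at h
    linarith [lt_min hs.2 ht.2, hF s hs.1 t ht.1 hst]
  have hP : P.card ≤ 1 := htransverse _ h₂ y
  have hQ : Q.card ≤ 1 := htransverse _ h₁ x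
  have hcover : S ⊆ P ∪ Q ∪ R := by
    intro s hs
    simp only [P, Q, R, Finset.mem_union, Finset.mem_filter, hs, true_and]
    by_contra! hcon
    obtain ⟨⟨hp, hq⟩, hr⟩ := hcon
    have h := hX x (f s y) (f s o) o
    rw [gromov_apply_apply] at h
    have := lt_min hr (show B + 2 * δ < dist o (f s o) - gromov y ((f s)⁻¹ o) o by
      linarith [h₃ s hs])
    linarith
  have hcard : S.card ≤ 2 + R.card := by
    have := (Finset.card_le_card hcover).trans (Finset.card_union_le _ _)
    have := Finset.card_union_le P Q
    omega
  have hncard : {s ∈ (S : Set (X ≃ᵢ X)) | gromov x (f s y) o ≤ B + 2 * δ}.ncard = R.card := by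
    rw [← Set.ncard_coe_finset]
    simp [R]
  rw [hncard]
  have : (S.card : ℝ) ≤ 2 + R.card := by exact_mod_cast hcard
  linarith

lemma isSchottky_of_transverse {δ B D η : ℝ} (hX : IsDeltaHyperbolic X δ) {o : X}
    {S : Finset (X ≃ᵢ X)} (hS : 2 ≤ η * S.card)
    (h₁ : ∀ s ∈ S, ∀ t ∈ S, s ≠ t → gromov (s o) (t o) o ≤ B)
    (h₂ : ∀ s ∈ S, ∀ t ∈ S, s ≠ t → gromov (s⁻¹ o) (t⁻¹ o) o ≤ B)
    (h₃ : ∀ s ∈ S, 2 * B + 3 * δ < dist o (s o)) (hD : ∀ s ∈ S, D ≤ dist o (s o)) :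
    IsSchottky o η (B + 2 * δ) D S := by
  refine ⟨fun x y => ?_, fun x y => ?_, hD⟩
  · have := card_sub_two_le_ncard hX S id h₁ h₂ h₃ x y
    simp only [id] at this
    linarith
  · have := card_sub_two_le_ncard hX S (fun s => s⁻¹) h₂ (by simpa using h₁)
      (by simpa only [dist_inv_apply] using h₃) x y
    linarith

lemma Loxodromic.tendsto_dist_pow {o : X} {g : X ≃ᵢ X} (hg : Loxodromic o g) :
    Tendsto (fun n : ℕ => dist o ((g ^ n) o)) atTop atTop := by
  obtain ⟨L, hL, hlim⟩ := hg
  refine (hlim.pos_mul_atTop hL tendsto_natCast_atTop_atTop).congr' ?_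
  filter_upwards [eventually_ne_atTop 0] with n hn
  field_simp

lemma DisjointFixedPointsAtInfinity.exists_uniform_bound {o : X} {u v : X ≃ᵢ X}
    (h : DisjointFixedPointsAtInfinity o u v) :
    ∃ B : ℝ, 0 ≤ B ∧ ∀ n m : ℕ, 1 ≤ n → 1 ≤ m →
      gromov ((u ^ n) o) ((v ^ m) o) o ≤ B ∧ gromov ((u ^ n)⁻¹ o) ((v ^ m) o) o ≤ B ∧
      gromov ((u ^ n) o) ((v ^ m)⁻¹ o) o ≤ B ∧ gromov ((u ^ n)⁻¹ o) ((v ^ m)⁻¹ o) o ≤ B := by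
  obtain ⟨B₁, h₁⟩ := h 1 1 (by simp) (by simp)
  obtain ⟨B₂, h₂⟩ := h (-1) 1 (by simp) (by simp)
  obtain ⟨B₃, h₃⟩ := h 1 (-1) (by simp) (by simp)
  obtain ⟨B₄, h₄⟩ := h (-1) (-1) (by simp) (by simp)
  simp only [one_mul, neg_mul, zpow_neg, zpow_natCast] at h₁ h₂ h₃ h₄
  refine ⟨|B₁| + |B₂| + |B₃| + |B₄|, by positivity, fun n m hn hm => ?_⟩
  have := abs_nonneg B₁
  have := abs_nonneg B₂
  have := abs_nonneg B₃
  have := abs_nonneg B₄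
  refine ⟨?_, ?_, ?_, ?_⟩
  · linarith [h₁ n m hn hm, le_abs_self B₁]
  · linarith [h₂ n m hn hm, le_abs_self B₂]
  · linarith [h₃ n m hn hm, le_abs_self B₃]
  · linarith [h₄ n m hn hm, le_abs_self B₄]

section ConvPow

variable {G : Type*} [Group G] {μ : PMF G}

lemma mem_support_convPow_succ {n : ℕ} {g : G} :
    g ∈ (convPow μ (n + 1)).support ↔
      ∃ a ∈ (convPow μ n).support, ∃ b ∈ μ.support, a * b = g := by
  simp only [convPow, PMF.mem_support_bind_iff, PMF.mem_support_map_iff]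

lemma mul_mem_support_convPow {m n : ℕ} {g h : G} (hg : g ∈ (convPow μ m).support)
    (hh : h ∈ (convPow μ n).support) : g * h ∈ (convPow μ (m + n)).support := by
  induction n generalizing h with
  | zero =>
    have : h = 1 := by simpa [convPow] using hh
    simpa [this] using hg
  | succ n ih =>
    obtain ⟨a, ha, b, hb, rfl⟩ := mem_support_convPow_succ.1 hh
    exact mem_support_convPow_succ.2 ⟨g * a, ih ha, b, hb, mul_assoc g a b⟩

lemma pow_mem_support_convPow {m : ℕ} {g : G} (hg : g ∈ (convPow μ m).support) (n : ℕ) :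
    g ^ n ∈ (convPow μ (m * n)).support := by
  induction n with
  | zero => simp [convPow]
  | succ n ih =>
    rw [pow_succ, Nat.mul_succ]
    exact mul_mem_support_convPow ih hg

lemma exists_mem_support_convPow_of_mem_closure {g : G}
    (hg : g ∈ Subsemigroup.closure μ.support) : ∃ m : ℕ, g ∈ (convPow μ m).support := by
  induction hg using Subsemigroup.closure_induction with
  | mem g hg =>
    exact ⟨1, mem_support_convPow_succ.2 ⟨1, by simp [convPow], g, hg, one_mul g⟩⟩
  | mul g h _ _ ihg ihh =>
    obtain ⟨m, hm⟩ := ihg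
    obtain ⟨n, hn⟩ := ihh
    exact ⟨m + n, mul_mem_support_convPow hm hn⟩

end ConvPow

/-- The Schottky sets can moreover be taken nonempty. They are the sets
`{a ^ i * v ^ n * a ^ (K - i) | i < K}`, where `a` is a large fixed power of `u`. -/
theorem exists_nonempty_schottky_set_in_convolution_support
    {δ : ℝ} (hδ : 0 ≤ δ) (hX : IsDeltaHyperbolic X δ)
    (o : X) (μ : PMF (X ≃ᵢ X)) (hμ : NonElementary o μ) {η : ℝ} (hη : 0 < η) :
    ∃ C : ℝ, 0 < C ∧ ∀ D : ℝ, ∃ M : ℕ, ∃ S : Finset (X ≃ᵢ X), S.Nonempty ∧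
      (↑S ⊆ (convPow μ M).support) ∧ IsSchottky o η C D S := by
  obtain ⟨u, v, hu, hv, hul, hvl, hdisj⟩ := hμ
  obtain ⟨m, hu⟩ := exists_mem_support_convPow_of_mem_closure hu
  obtain ⟨k, hv⟩ := exists_mem_support_convPow_of_mem_closure hv
  obtain ⟨B, hB₀, hB⟩ := hdisj.exists_uniform_bound
  obtain ⟨p, hp₁, hp⟩ : ∃ p : ℕ, 1 ≤ p ∧ ∀ q ≥ p, 2 * B + δ < dist o ((u ^ q) o) := by
    obtain ⟨p, hp⟩ := eventually_atTop.1 (hul.tendsto_dist_pow.eventually_gt_atTop (2 * B + δ))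
    exact ⟨p + 1, by omega, fun q hq => hp q (by omega)⟩
  set a := u ^ p with ha
  have hmul : ∀ i : ℕ, 1 ≤ i → p ≤ p * i := fun i hi => Nat.le_mul_of_pos_right p hi
  have hapow : ∀ i : ℕ, 1 ≤ i → 2 * B + δ < dist o ((a ^ i) o) := fun i hi => by
    rw [ha, ← pow_mul]
    exact hp _ (hmul i hi)
  have haB : ∀ n i : ℕ, 1 ≤ n → 1 ≤ i →
      gromov ((a ^ i) o) ((v ^ n) o) o ≤ B ∧ gromov ((a ^ i)⁻¹ o) ((v ^ n) o) o ≤ B ∧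
      gromov ((a ^ i) o) ((v ^ n)⁻¹ o) o ≤ B ∧ gromov ((a ^ i)⁻¹ o) ((v ^ n)⁻¹ o) o ≤ B := by
    intro n i hn hi
    rw [ha, ← pow_mul]
    exact hB _ n (hp₁.trans (hmul i hi)) hn
  obtain ⟨K, hK⟩ := exists_nat_gt (2 / η)
  have hK₀ : 0 < K := by
    have : (0 : ℝ) < K := lt_trans (by positivity) hK
    exact_mod_cast this
  set R := K * dist o (a o) with hR
  have hR₀ : 0 ≤ R := by positivity
  set B' := B + δ + 3 * R with hB'
  refine ⟨B' + 1 + 2 * δ, by positivity, fun D => ?_⟩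
  obtain ⟨n, hn₁, hn⟩ : ∃ n : ℕ, 1 ≤ n ∧
      max D (2 * (B' + 1) + 3 * δ) + 2 * R < dist o ((v ^ n) o) := by
    obtain ⟨n, hn⟩ := ((eventually_ge_atTop 1).and (hvl.tendsto_dist_pow.eventually_gt_atTop
      (max D (2 * (B' + 1) + 3 * δ) + 2 * R))).exists
    exact ⟨n, hn⟩
  set s : ℕ → (X ≃ᵢ X) := fun i => a ^ i * v ^ n * a ^ (K - i) with hs
  have hs_inv : ∀ i, (s i)⁻¹ = a⁻¹ ^ (K - i) * (v ^ n)⁻¹ * a⁻¹ ^ i := fun i => by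
    simp [hs, mul_assoc]
  have hdist : ∀ i ≤ K, max D (2 * (B' + 1) + 3 * δ) < dist o (s i o) := by
    intro i hi
    have hpow : ∀ j ≤ K, dist o ((a ^ j) o) ≤ R := fun j hj =>
      (dist_pow_apply_le a o j).trans (by rw [hR]; gcongr)
    have hv_eq : v ^ n = (a ^ i)⁻¹ * s i * (a ^ (K - i))⁻¹ := by
      simp only [hs]
      group
    have h₁ := dist_mul_apply_le ((a ^ i)⁻¹ * s i) (a ^ (K - i))⁻¹ o
    have h₂ := dist_mul_apply_le (a ^ i)⁻¹ (s i) o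
    rw [← hv_eq, dist_inv_apply] at h₁
    rw [dist_inv_apply] at h₂
    linarith [hpow i hi, hpow (K - i) (by omega)]
  have hprod : ∀ i < K, ∀ j < K, i ≠ j → gromov (s i o) (s j o) o ≤ B' := by
    intro i hi j hj hij
    exact gromov_pow_mul_pow_le hX (fun q hq => (haB n q hn₁ hq).1)
      (fun q hq => (haB n q hn₁ hq).2.1) hapow hi.le hj.le (by omega) (by omega) hij
  have hprod_inv : ∀ i < K, ∀ j < K, i ≠ j → gromov ((s i)⁻¹ o) ((s j)⁻¹ o) o ≤ B' := by
    intro i hi j hj hij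
    rw [hs_inv, hs_inv, hB', hR, ← dist_inv_apply a]
    refine gromov_pow_mul_pow_le hX ?_ ?_ ?_ (by omega) (by omega) hi.le hj.le (by omega)
    · intro q hq
      rw [inv_pow]
      exact (haB n q hn₁ hq).2.2.2
    · intro q hq
      rw [inv_pow, inv_inv]
      exact (haB n q hn₁ hq).2.2.1
    · intro q hq
      rw [inv_pow, dist_inv_apply]
      exact hapow q hq
  have hinj : Set.InjOn s (Finset.range K : Set ℕ) := by
    intro i hi j hj hij
    by_contra hne
    simp only [Finset.coe_range, Set.mem_Iio] at hi hj
    have h₁ := hprod i hi j hj hne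
    rw [← hij, gromov_self] at h₁
    have h₂ := (le_max_right _ _).trans_lt (hdist i hi.le)
    have : 0 ≤ B' := by positivity
    linarith
  refine ⟨m * p * K + k * n, (Finset.range K).image s, ?_, ?_, ?_⟩
  · exact (Finset.nonempty_range_iff.2 hK₀.ne').image s
  · intro g hg
    simp only [Finset.coe_image, Finset.coe_range, Set.mem_image, Set.mem_Iio] at hg
    obtain ⟨i, hi, rfl⟩ := hg
    have hau := pow_mem_support_convPow hu p
    have hmem := mul_mem_support_convPow (mul_mem_support_convPow
      (pow_mem_support_convPow hau i) (pow_mem_support_convPow hv n))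
      (pow_mem_support_convPow hau (K - i))
    have hlen : m * p * i + k * n + m * p * (K - i) = m * p * K + k * n := by
      rw [add_right_comm, ← mul_add, Nat.add_sub_cancel' hi.le]
    rwa [hlen] at hmem
  · refine isSchottky_of_transverse hX ?_ ?_ ?_ ?_ ?_
    · rw [Finset.card_image_of_injOn hinj, Finset.card_range]
      rw [div_lt_iff₀ hη] at hK
      linarith
    · simp only [Finset.forall_mem_image, Finset.mem_range]
      intro i hi j hj hij
      linarith [hprod i hi j hj (fun h => hij (h ▸ rfl))]
    · simp only [Finset.forall_mem_image, Finset.mem_range]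
      intro i hi j hj hij
      linarith [hprod_inv i hi j hj (fun h => hij (h ▸ rfl))]
    · simp only [Finset.forall_mem_image, Finset.mem_range]
      exact fun i hi => (le_max_right _ _).trans_lt (hdist i hi.le)
    · simp only [Finset.forall_mem_image, Finset.mem_range]
      exact fun i hi => ((le_max_left _ _).trans_lt (hdist i hi.le)).le

end Schottky

/-- **Corollary 3.11 (Schottky sets in the support of convolution powers).** -/
theorem exists_schottky_set_in_convolution_support
    {X : Type*} [MetricSpace X] {δ : ℝ} (hδ : 0 ≤ δ) (hX : IsDeltaHyperbolic X δ)
    (o : X) (μ : PMF (X ≃ᵢ X)) (hμ : NonElementary o μ) :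
    ∀ η : ℝ, 0 < η → ∃ C : ℝ, 0 < C ∧ ∀ D : ℝ, 0 < D →
      ∃ M : ℕ, ∃ S : Finset (X ≃ᵢ X),
        (↑S ⊆ (convPow μ M).support) ∧ IsSchottky o η C D S := by
  intro η hη
  obtain ⟨C, hC, h⟩ := exists_nonempty_schottky_set_in_convolution_support hδ hX o μ hμ hη
  refine ⟨C, hC, fun D _ => ?_⟩
  obtain ⟨M, S, -, hS⟩ := h D
  exact ⟨M, S, hS⟩

end
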